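/- arXiv:1304.4626 — 2 statements merged into one kernel-verified Lean document; each statement's English description precedes it below -/
import Mathlib

section
/- Let M = (E, I) be a matroid on a finite ground set E that is representable over a field F (of arbitrary rank), let p, q be natural numbers, and let S be a finite family of independent sets of M, each of size p. Then there exists a subfamily Ŝ ⊆ S with |Ŝ| ≤ C(p+q, p) (the binomial coefficient) that is q-representative for S. -/
/-- A matroid `M` is representable over a field `𝔽` if there is an assignment of vectors
(columns of a matrix) to the elements of the ground set such that a subset of the ground set
is independent in `M` exactly when the corresponding vectors are linearly independent. -/
def MatroidRepresentable {α : Type*} (M : Matroid α) (𝔽 : Type*) [Field 𝔽] : Prop :=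
  ∃ (n : ℕ) (v : α → (Fin n → 𝔽)),
    ∀ I : Set α, I ⊆ M.E → (M.Indep I ↔ LinearIndependent 𝔽 (fun x : I => v x))

/-- `Shat ⊆ S` is a `q`-representative subfamily of `S` with respect to the matroid `M`:
for every `Y ⊆ M.E` with `|Y| ≤ q`, whenever some `X ∈ S` is disjoint from `Y` with
`X ∪ Y` independent, some `X̂ ∈ Shat` is disjoint from `Y` with `X̂ ∪ Y` independent. -/
def QRepFam {α : Type*} (M : Matroid α) (q : ℕ) (S Shat : Set (Set α)) : Prop :=
  Shat ⊆ S ∧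
    ∀ Y : Set α, Y ⊆ M.E → Y.encard ≤ (q : ℕ∞) →
      ∀ X ∈ S, Disjoint X Y → M.Indep (X ∪ Y) →
        ∃ Xhat ∈ Shat, Disjoint Xhat Y ∧ M.Indep (Xhat ∪ Y)

section LinearAlgebra

variable {K V : Type*} [Field K] [AddCommGroup V] [Module K V]

theorem ExteriorAlgebra.ιMulti_ne_zero_iff {n : ℕ} {a : Fin n → V} :
    ExteriorAlgebra.ιMulti K n a ≠ 0 ↔ LinearIndependent K a := by
  refine ⟨fun h => by_contra fun hn => h (AlternatingMap.map_linearDependent _ _ hn), fun h => ?_⟩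
  have hne := (exteriorPower.ιMulti_family_linearIndependent_field (n := n) h).ne_zero
    (Set.powersetCard.ofFinEmbEquiv (RelEmbedding.refl (· ≤ ·)))
  contrapose! hne
  apply Subtype.ext
  simpa [ExteriorAlgebra.ιMulti_family] using hne

/-- Over an infinite field, finitely many subspaces of dimension at most `d` can be avoided
simultaneously by a subspace of codimension at most `d`. -/
theorem Submodule.exists_finrank_quotient_le_forall_disjoint [Infinite K] [FiniteDimensional K V]
    (d : ℕ) {𝒲 : Set (Submodule K V)} (hfin : 𝒲.Finite)
    (hd : ∀ W ∈ 𝒲, Module.finrank K W ≤ d) :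
    ∃ U : Submodule K V, Module.finrank K (V ⧸ U) ≤ d ∧ ∀ W ∈ 𝒲, Disjoint U W := by
  classical
  obtain ⟨U, hU⟩ := exists_maximal_of_wellFoundedGT
    (fun U : Submodule K V => ∀ W ∈ 𝒲, Disjoint U W) ⟨⊥, fun _ _ => disjoint_bot_left⟩
  refine ⟨U, ?_, hU.prop⟩
  by_contra! hlt
  have hquot := U.finrank_quotient_add_finrank
  have hsup : ∀ W ∈ 𝒲, U ⊔ W ≠ ⊤ := fun W hW htop => by
    have hle := Submodule.finrank_add_le_finrank_add_finrank U W
    rw [htop, finrank_top] at hle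
    have := hd W hW
    omega
  have hUtop : U ≠ ⊤ := fun h => by
    rw [h, finrank_top] at hquot
    rw [h] at hlt
    omega
  obtain ⟨w, hw⟩ := (Set.ne_univ_iff_exists_notMem _).1 <|
    Subspace.biUnion_ne_univ_of_top_notMem (s := insert U (hfin.toFinset.image (U ⊔ ·))) <| by
      simpa [hUtop.symm] using hsup
  simp only [Set.mem_iUnion, not_exists, Finset.mem_insert, Finset.mem_image,
    Set.Finite.mem_toFinset, SetLike.mem_coe] at hw
  refine hw U (.inl rfl) (hU.le_of_ge (y := K ∙ w ⊔ U) (fun W hW => ?_) le_sup_right ?_)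
  · refine (hU.prop W hW).disjoint_sup_left_of_disjoint_sup_right ?_
    rw [disjoint_comm, Submodule.disjoint_span_singleton]
    exact fun h => absurd h (hw _ (.inr ⟨W, hW, rfl⟩))
  · exact Submodule.mem_sup_left (Submodule.mem_span_singleton_self w)

/-- Lovász's two families argument: among any family of `p`-tuples of vectors of a space of
dimension `d`, at most `d.choose p` suffice to extend every tuple that the family extends to a
linearly independent one. -/
theorem LinearIndependent.exists_ncard_le_choose_append [FiniteDimensional K V] {ι : Type*} {p : ℕ}
    (a : ι → Fin p → V) :
    ∃ T : Set ι, T.ncard ≤ (Module.finrank K V).choose p ∧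
      ∀ (i : ι) (r : ℕ) (b : Fin r → V), LinearIndependent K (Fin.append (a i) b) →
        ∃ j ∈ T, LinearIndependent K (Fin.append (a j) b) := by
  let f : ι → ⋀[K]^p V := fun i => exteriorPower.ιMulti K p (a i)
  obtain ⟨t, hts, htcard, htspan, -⟩ := Submodule.exists_finset_span_eq_linearIndepOn K (Set.range f)
  obtain ⟨T, hT⟩ := Set.exists_subset_bijOn (f ⁻¹' t) f
  obtain ⟨-, hT⟩ := hT
  rw [Set.image_preimage_eq_of_subset hts] at hT
  refine ⟨T, ?_, fun i r b hi => ?_⟩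
  · rw [← hT.injOn.ncard_image, hT.image_eq, Set.ncard_coe_finset, htcard,
      ← exteriorPower.finrank_eq K p]
    exact Submodule.finrank_le _
  · simp_rw [← ExteriorAlgebra.ιMulti_ne_zero_iff, ← ExteriorAlgebra.ιMulti_mul_ιMulti] at hi ⊢
    by_contra! h
    let g : ⋀[K]^p V →ₗ[K] ExteriorAlgebra K V :=
      LinearMap.mulRight K (ExteriorAlgebra.ιMulti K r b) ∘ₗ Submodule.subtype _
    have hker : Submodule.span K (t : Set (⋀[K]^p V)) ≤ LinearMap.ker g := by
      rw [Submodule.span_le, ← hT.image_eq]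
      rintro _ ⟨j, hj, rfl⟩
      exact h j hj
    exact hi (hker (htspan ▸ Submodule.subset_span ⟨i, rfl⟩ : f i ∈ _))

theorem linearIndependent_append_comp_iff {α : Type*} (v : α → V) {m n : ℕ} {x : Fin m → α}
    {y : Fin n → α} (hx : x.Injective) (hy : y.Injective) :
    LinearIndependent K (Fin.append (v ∘ x) (v ∘ y)) ↔
      Disjoint (Set.range x) (Set.range y) ∧ LinearIndepOn K v (Set.range x ∪ Set.range y) := by
  have hcomp : Fin.append (v ∘ x) (v ∘ y) = v ∘ Fin.append x y := by
    ext i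
    induction i using Fin.addCases <;> simp
  have hrange : Set.range (Fin.append x y) = Set.range x ∪ Set.range y := by
    rw [← Set.Sum.elim_range, ← Fin.append_comp_sumElim]
    exact (finSumFinEquiv.surjective.range_comp (Fin.append x y)).symm
  have hinj : (Fin.append x y).Injective ↔ Disjoint (Set.range x) (Set.range y) := by
    simp [Fin.append_injective_iff, hx, hy, Set.disjoint_range_iff]
  rw [hcomp, ← hrange, ← hinj]
  refine ⟨fun h => ?_, fun h => (linearIndepOn_range_iff h.1 v).1 h.2⟩
  have hi : (Fin.append x y).Injective := h.injective.of_comp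
  exact ⟨hi, (linearIndepOn_range_iff hi v).2 h⟩

end LinearAlgebra

theorem Set.exists_injective_range_eq_of_encard_eq {α : Type*} {s : Set α} {n : ℕ}
    (h : s.encard = n) : ∃ f : Fin n → α, f.Injective ∧ Set.range f = s := by
  have hs : s.Finite := Set.finite_of_encard_eq_coe h
  have := hs.fintype
  have hc : Fintype.card s = n := by
    rw [← Nat.card_eq_fintype_card, Nat.card_coe_set_eq, Set.ncard, h, ENat.toNat_natCast]
  let e := Fintype.equivFinOfCardEq hc
  exact ⟨fun i => e.symm i, Subtype.val_injective.comp e.symm.injective, by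
    change Set.range (Subtype.val ∘ e.symm) = s
    rw [e.symm.surjective.range_comp, Subtype.range_coe]⟩

/-- The independent sets of size at most `d` of a representable matroid on a finite ground set
remain independent in a suitable representation of dimension at most `d` over an infinite
extension field, all of whose independent sets are independent in the matroid. -/
theorem MatroidRepresentable.exists_truncation {α 𝔽 : Type*} [Field 𝔽] {M : Matroid α}
    (hE : M.E.Finite) (hrep : MatroidRepresentable M 𝔽) (d : ℕ) :
    ∃ (n : ℕ) (U : Submodule (AlgebraicClosure 𝔽) (Fin n → AlgebraicClosure 𝔽))
      (w : α → (Fin n → AlgebraicClosure 𝔽) ⧸ U),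
      Module.finrank (AlgebraicClosure 𝔽) ((Fin n → AlgebraicClosure 𝔽) ⧸ U) ≤ d ∧
      (∀ I ⊆ M.E, LinearIndepOn (AlgebraicClosure 𝔽) w I → M.Indep I) ∧
      ∀ I, M.Indep I → I.encard ≤ d → LinearIndepOn (AlgebraicClosure 𝔽) w I := by
  obtain ⟨n, v, hv⟩ := hrep
  let u : α → Fin n → AlgebraicClosure 𝔽 := fun x => algebraMap 𝔽 (AlgebraicClosure 𝔽) ∘ v x
  have hu : ∀ I ⊆ M.E, (M.Indep I ↔ LinearIndepOn (AlgebraicClosure 𝔽) u I) := fun I hI =>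
    (hv I hI).trans linearIndependent_algebraMap_comp_iff.symm
  let 𝓘 : Set (Set α) := {I | M.Indep I ∧ I.encard ≤ d}
  have h𝓘 : 𝓘.Finite := hE.finite_subsets.subset fun I hI => hI.1.subset_ground
  obtain ⟨U, hUd, hU⟩ := Submodule.exists_finrank_quotient_le_forall_disjoint d
    (h𝓘.image fun I => Submodule.span (AlgebraicClosure 𝔽) (u '' I)) <| by
      rintro _ ⟨I, hI, rfl⟩
      have hfin : I.Finite := Set.finite_of_encard_le_coe hI.2
      have := (hfin.image u).fintype
      refine (finrank_span_le_card (u '' I)).trans ?_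
      rw [← Set.ncard_eq_toFinset_card']
      refine (Set.ncard_image_le hfin).trans ?_
      have := hI.2
      rwa [← hfin.cast_ncard_eq, Nat.cast_le] at this
  refine ⟨n, U, U.mkQ ∘ u, hUd, fun I hI h => (hu I hI).2 (LinearIndependent.of_comp U.mkQ h),
    fun I hI hId => ?_⟩
  refine LinearIndependent.map ((hu I hI.subset_ground).1 hI) ?_
  rw [Submodule.ker_mkQ, disjoint_comm, ← Set.image_eq_range]
  exact hU _ ⟨I, ⟨hI, hId⟩, rfl⟩

/-- Let `M` be a matroid on a finite ground set, representable over a field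
`𝔽` (of arbitrary rank), and let `S` be a finite family of independent sets of `M`, each of
size `p`. Then there is a subfamily `Shat ⊆ S` of size at most `C(p+q, p)` which is
`q`-representative for `S`. -/
theorem stmt1 {α 𝔽 : Type*} [Field 𝔽] (M : Matroid α) (hE : M.E.Finite)
    (hrep : MatroidRepresentable M 𝔽) (p q : ℕ)
    (S : Set (Set α)) (hSfin : S.Finite)
    (hS : ∀ X ∈ S, M.Indep X ∧ X.encard = (p : ℕ∞)) :
    ∃ Shat : Set (Set α), Shat.ncard ≤ (p + q).choose p ∧ QRepFam M q S Shat := by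
  obtain ⟨n, U, w, hUd, hw, hw'⟩ := hrep.exists_truncation hE (p + q)
  choose x hx hxr using fun X : S => Set.exists_injective_range_eq_of_encard_eq (hS X X.2).2
  obtain ⟨T, hTcard, hT⟩ := LinearIndependent.exists_ncard_le_choose_append
    (K := AlgebraicClosure 𝔽) fun X : S => w ∘ x X
  refine ⟨Subtype.val '' T, ?_, Subtype.coe_image_subset S T, fun Y hYE hYq X hX hXY hind => ?_⟩
  · rw [Set.ncard_image_of_injective _ Subtype.val_injective]
    exact hTcard.trans (Nat.choose_le_choose p hUd)
  · obtain ⟨r, hr⟩ := ENat.ne_top_iff_exists.1 (ne_top_of_le_ne_top (ENat.natCast_ne_top q) hYq)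
    obtain ⟨y, hy, rfl⟩ := Set.exists_injective_range_eq_of_encard_eq hr.symm
    have hcard : (X ∪ Set.range y).encard ≤ ((p + q : ℕ) : ℕ∞) := by
      rw [Set.encard_union_eq hXY, (hS X hX).2, Nat.cast_add]
      gcongr
    obtain ⟨Z, hZT, hZ⟩ := hT ⟨X, hX⟩ r (w ∘ y) <| by
      rw [linearIndependent_append_comp_iff w (hx _) hy, hxr]
      exact ⟨hXY, hw' _ hind hcard⟩
    rw [linearIndependent_append_comp_iff w (hx _) hy, hxr] at hZ
    exact ⟨Z, ⟨Z, hZT, rfl⟩, hZ.1,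
      hw _ (Set.union_subset (hS Z Z.2).1.subset_ground hYE) hZ.2⟩
end

section
/- Let T be a finite tree rooted at a vertex r and let W ⊆ V(T) be a set of vertices such that for every pair of vertices u, v ∈ W, the least common ancestor of u and v in the rooted tree T is also in W. Then every connected component U of T − W satisfies |N_T(U)| ≤ 2. -/
/-- The neighborhood `N_G(U)`: vertices outside `U` adjacent to some vertex of `U`. -/
def Nbhd {V : Type*} (G : SimpleGraph V) (U : Set V) : Set V :=
  {v | v ∉ U ∧ ∃ u ∈ U, G.Adj u v}

/-- `U` is a connected component of `G − W`: `U` is a nonempty set of vertices disjoint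
from `W`, inducing a connected subgraph, and every neighbor of `U` outside `U` lies
in `W`. -/
def IsCompOutside {V : Type*} (G : SimpleGraph V) (W U : Set V) : Prop :=
  U.Nonempty ∧ Disjoint U W ∧ (SimpleGraph.induce U G).Connected ∧
    ∀ u ∈ U, ∀ v : V, G.Adj u v → v ∉ U → v ∈ W

/-- In the graph `T` rooted at `r`, the vertex `a` is an ancestor of `v`: `a` lies on
a (in a tree: the unique) path from `v` to `r`. -/
def IsAncestor {V : Type*} (T : SimpleGraph V) (r a v : V) : Prop :=
  ∃ p : T.Walk v r, p.IsPath ∧ a ∈ p.support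

/-- In the graph `T` rooted at `r`, the vertex `a` is a least common ancestor of `u` and
`v`: it is a common ancestor of `u` and `v` that is farthest from the root `r`. -/
def IsLCA {V : Type*} (T : SimpleGraph V) (r u v a : V) : Prop :=
  IsAncestor T r a u ∧ IsAncestor T r a v ∧
    ∀ b : V, IsAncestor T r b u → IsAncestor T r b v → T.dist r b ≤ T.dist r a

/-- In the graph `T` rooted at `r`, the vertex `w` is a parent of `v`: it is adjacent to `v` and
one step closer to the root. -/
def IsParent {V : Type*} (T : SimpleGraph V) (r w v : V) : Prop :=
  T.Adj v w ∧ T.dist r v = T.dist r w + 1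

section Tree

variable {V : Type*} {T : SimpleGraph V} {r : V}

theorem SimpleGraph.IsTree.length_eq_dist_of_isPath (hT : T.IsTree) {v w : V} {p : T.Walk v w}
    (hp : p.IsPath) : p.length = T.dist v w := by
  obtain ⟨q, hq, hlen⟩ := hT.connected.exists_path_of_dist v w
  rw [(hT.existsUnique_path v w).unique hp hq, hlen]

theorem IsParent.isPath_cons (hT : T.IsTree) {v w : V}
    (h : IsParent T r w v) {q : T.Walk w r} (hq : q.IsPath) : (SimpleGraph.Walk.cons h.1 q).IsPath := by
  apply SimpleGraph.Walk.isPath_of_length_eq_dist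
  rw [SimpleGraph.Walk.length_cons, hT.length_eq_dist_of_isPath hq, T.dist_comm (u := v),
    T.dist_comm (u := w), h.2]

theorem isParent_or_isParent_of_adj (hT : T.IsTree) {v w : V} (h : T.Adj v w) :
    IsParent T r w v ∨ IsParent T r v w :=
  (hT.dist_eq_dist_add_one_of_adj r h).imp (fun e => ⟨h, e⟩) (fun e => ⟨h.symm, e⟩)

theorem IsParent.unique (hT : T.IsTree) {v w w' : V} (h : IsParent T r w v)
    (h' : IsParent T r w' v) : w = w' := by
  obtain ⟨q, hq, -⟩ := hT.connected.exists_path_of_dist w r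
  obtain ⟨q', hq', -⟩ := hT.connected.exists_path_of_dist w' r
  have e := (hT.existsUnique_path v r).unique (h.isPath_cons hT hq) (h'.isPath_cons hT hq')
  simpa using congrArg SimpleGraph.Walk.snd e

theorem isAncestor_refl (hT : T.IsTree) (v : V) : IsAncestor T r v v := by
  obtain ⟨q, hq, -⟩ := hT.connected.exists_path_of_dist v r
  exact ⟨q, hq, q.start_mem_support⟩

theorem IsParent.isAncestor_iff (hT : T.IsTree) {a v w : V} (h : IsParent T r w v) :
    IsAncestor T r a v ↔ a = v ∨ IsAncestor T r a w := by
  obtain ⟨q, hq, -⟩ := hT.connected.exists_path_of_dist w r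
  constructor
  · rintro ⟨p, hp, ha⟩
    rw [(hT.existsUnique_path v r).unique hp (h.isPath_cons hT hq),
      SimpleGraph.Walk.support_cons, List.mem_cons] at ha
    exact ha.imp_right fun ha => ⟨q, hq, ha⟩
  · rintro (rfl | ⟨p, hp, ha⟩)
    · exact isAncestor_refl hT a
    · exact ⟨_, h.isPath_cons hT hp, List.mem_cons_of_mem _ ha⟩

theorem IsAncestor.eq_of_dist_le (hT : T.IsTree) {a v : V} (h : IsAncestor T r a v)
    (hd : T.dist r v ≤ T.dist r a) : a = v := by
  classical
  obtain ⟨p, hp, ha⟩ := h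
  by_contra hne
  have hlt := SimpleGraph.Walk.length_dropUntil_lt_length ha hne
  rw [hT.length_eq_dist_of_isPath hp, hT.length_eq_dist_of_isPath (hp.dropUntil ha),
    T.dist_comm (u := a), T.dist_comm (u := v)] at hlt
  omega

/-- Two vertices of a finite rooted tree have a least common ancestor. -/
theorem exists_isLCA [Finite V] (hT : T.IsTree) (u v : V) : ∃ a, IsLCA T r u v a := by
  have hr : ∀ x, IsAncestor T r r x := fun x => by
    obtain ⟨q, hq, -⟩ := hT.connected.exists_path_of_dist x r
    exact ⟨q, hq, q.end_mem_support⟩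
  obtain ⟨a, ha, hmax⟩ := Set.exists_max_image {a | IsAncestor T r a u ∧ IsAncestor T r a v}
    (T.dist r) (Set.toFinite _) ⟨r, hr u, hr v⟩
  exact ⟨a, ha.1, ha.2, fun b hu hv => hmax b ⟨hu, hv⟩⟩

/-- A connected vertex set `U` of a rooted tree has a top vertex `t`: from each vertex of `U`,
moving to parents reaches `t` without leaving `U`. -/
theorem exists_forall_reflTransGen_isParent (hT : T.IsTree) {U : Set V}
    (hU : (SimpleGraph.induce U T).Connected) :
    ∃ t ∈ U, ∀ v ∈ U,
      Relation.ReflTransGen (fun v w => IsParent T r w v ∧ v ∈ U ∧ w ∈ U) v t := by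
  obtain ⟨⟨x, hx⟩⟩ := hU.nonempty
  obtain ⟨t, ht, hmin⟩ := exists_minimal_of_wellFoundedLT (fun n => ∃ t ∈ U, T.dist r t = n)
    ⟨_, x, hx, rfl⟩
  obtain ⟨t, htU, rfl⟩ := ht
  refine ⟨t, htU, fun v hv => ?_⟩
  have hreach := (SimpleGraph.reachable_iff_reflTransGen _ _).1 (hU.preconnected ⟨t, htU⟩ ⟨v, hv⟩)
  suffices ∀ y : U, Relation.ReflTransGen (SimpleGraph.induce U T).Adj ⟨t, htU⟩ y →
      Relation.ReflTransGen (fun v w => IsParent T r w v ∧ v ∈ U ∧ w ∈ U) y t from this _ hreach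
  intro y hy
  induction hy with
  | refl => exact .refl
  | @tail y z _ hyz ih =>
    rcases isParent_or_isParent_of_adj (r := r) hT (show T.Adj y z from hyz) with h | h
    · rcases ih.cases_head with e | ⟨w, ⟨hw, -, -⟩, hwt⟩
      · have := hmin (y := T.dist r z) ⟨z, z.2, rfl⟩ (by rw [← e, h.2]; omega)
        rw [← e, h.2] at this
        omega
      · rwa [h.unique hT hw]
    · exact .head ⟨h, z.2, y.2⟩ ih

theorem IsAncestor.mem_of_reflTransGen_isParent (hT : T.IsTree) {U : Set V} {a t u : V}
    (htU : t ∈ U)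
    (hu : Relation.ReflTransGen (fun v w => IsParent T r w v ∧ v ∈ U ∧ w ∈ U) u t)
    (ha : IsAncestor T r a u) (hd : T.dist r t ≤ T.dist r a) : a ∈ U := by
  induction hu using Relation.ReflTransGen.head_induction_on with
  | refl => rwa [ha.eq_of_dist_le hT hd]
  | head h _ ih =>
    rcases (h.1.isAncestor_iff hT).1 ha with rfl | ha
    · exact h.2.1
    · exact ih ha

theorem isAncestor_of_reflTransGen_isParent (hT : T.IsTree) {U : Set V} {t u : V}
    (hu : Relation.ReflTransGen (fun v w => IsParent T r w v ∧ v ∈ U ∧ w ∈ U) u t) :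
    IsAncestor T r t u := by
  induction hu using Relation.ReflTransGen.head_induction_on with
  | refl => exact isAncestor_refl hT t
  | head h _ ih => exact (h.1.isAncestor_iff hT).2 (.inr ih)

end Tree


/-- Let `T` be a finite tree rooted at `r` and let `W ⊆ V(T)` be closed
under taking least common ancestors. Then every connected component `U` of `T − W`
satisfies `|N_T(U)| ≤ 2`. -/
theorem stmt17 {V : Type*} [Fintype V] (T : SimpleGraph V) (hT : T.IsTree) (r : V)
    (W : Set V)
    (hclosed : ∀ u ∈ W, ∀ v ∈ W, ∀ a : V, IsLCA T r u v a → a ∈ W)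
    (U : Set V) (hU : IsCompOutside T W U) :
    (Nbhd T U).ncard ≤ 2 := by
  obtain ⟨-, hdisj, hconn, hW⟩ := hU
  obtain ⟨t, htU, ht⟩ := exists_forall_reflTransGen_isParent (r := r) hT hconn
  have hup : {x | x ∉ U ∧ ∃ u ∈ U, IsParent T r x u}.Subsingleton := by
    have htop : ∀ x ∈ {x | x ∉ U ∧ ∃ u ∈ U, IsParent T r x u}, IsParent T r x t := by
      rintro x ⟨hx, u, hu, hxu⟩
      rcases (ht u hu).cases_head with rfl | ⟨w, ⟨hw, -, hwU⟩, -⟩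
      · exact hxu
      · exact absurd (hxu.unique hT hw ▸ hwU) hx
    exact fun x hx y hy => (htop x hx).unique hT (htop y hy)
  have hdown : {x | x ∉ U ∧ ∃ u ∈ U, IsParent T r u x}.Subsingleton := by
    rintro x ⟨hx, u, hu, hux⟩ y ⟨hy, v, hv, hvy⟩
    obtain ⟨a, hax, hay, hmax⟩ := exists_isLCA (r := r) hT x y
    have haW := hclosed x (hW u hu x hux.1.symm hx) y (hW v hv y hvy.1.symm hy) a
      ⟨hax, hay, hmax⟩
    have hd := hmax t
      ((hux.isAncestor_iff hT).2 (.inr (isAncestor_of_reflTransGen_isParent hT (ht u hu))))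
      ((hvy.isAncestor_iff hT).2 (.inr (isAncestor_of_reflTransGen_isParent hT (ht v hv))))
    have haU : a ∉ U := fun h => Set.disjoint_left.1 hdisj h haW
    have eq_of_child : ∀ z w, w ∈ U → IsParent T r w z → IsAncestor T r a z → a = z :=
      fun z w hw hwz haz => ((hwz.isAncestor_iff hT).1 haz).resolve_right fun haw =>
        haU (haw.mem_of_reflTransGen_isParent hT htU (ht w hw) hd)
    exact (eq_of_child x u hu hux hax).symm.trans (eq_of_child y v hv hvy hay)
  have hsub : Nbhd T U ⊆ {x | x ∉ U ∧ ∃ u ∈ U, IsParent T r x u} ∪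
      {x | x ∉ U ∧ ∃ u ∈ U, IsParent T r u x} := by
    rintro x ⟨hx, u, hu, hadj⟩
    exact (isParent_or_isParent_of_adj hT hadj).imp (fun h => ⟨hx, u, hu, h⟩)
      (fun h => ⟨hx, u, hu, h⟩)
  calc (Nbhd T U).ncard ≤ _ := Set.ncard_le_ncard hsub (Set.toFinite _)
    _ ≤ _ := Set.ncard_union_le _ _
    _ ≤ 1 + 1 := add_le_add (Set.ncard_le_one_iff_subsingleton.2 hup)
      (Set.ncard_le_one_iff_subsingleton.2 hdown)
end
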